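/- arXiv:1911.12217 — 6 statements merged into one kernel-verified Lean document; each statement's English description precedes it below -/
import Mathlib

section
/- Let h > 0 with σ(h) > 0, let p ∈ ℝ² with q := ‖p‖ > 0, assume α is differentiable at q² with α(q²) > 0, E_cap is differentiable at q, and α(s)²·s = 2·E_cap(√s) for all s > 0. Set v := α(q²)·√(σ(h)/h)·p and f(h,v) := √(σ(h))·√h·( (2·α'(q²)·h/(α(q²)²·σ(h)))·(v ⊗ v) + α(q²)·I ). Then f(h,v)·v = √(σ(h)·h)·(α(q²) + 2·α'(q²)·q²)·v = σ(h)·(α(q²)² + 2·α(q²)·α'(q²)·q²)·p, and this vector equals the gradient at p of the map p ↦ E(h,p) := Φ(h) + σ(h)·E_cap(‖p‖), namely σ(h)·E_cap'(q)·p/q. -/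
open Matrix in
/-- The action of `a • (x ⊗ x) + b • I` on `x` is multiplication by `a * ‖x‖ ^ 2 + b`. -/
theorem smul_vecMulVec_self_add_smul_one_mulVec {ι : Type*} [Fintype ι] [DecidableEq ι]
    (a b : ℝ) (x : EuclideanSpace ℝ ι) :
    (a • vecMulVec x x + b • (1 : Matrix ι ι ℝ)) *ᵥ x = (a * ‖x‖ ^ 2 + b) • (x : ι → ℝ) := by
  have hx : (x : ι → ℝ) ⬝ᵥ x = ‖x‖ ^ 2 := by
    rw [EuclideanSpace.real_norm_sq_eq]
    simp [dotProduct, sq]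
  rw [add_mulVec, smul_mulVec, smul_mulVec, one_mulVec, vecMulVec_mulVec, hx]
  ext i
  simp
  ring

/-- The gradient of a radial function away from the origin. -/
theorem HasDerivAt.hasGradientAt_comp_norm {F : Type*} [NormedAddCommGroup F]
    [InnerProductSpace ℝ F] [CompleteSpace F] {g : ℝ → ℝ} {g' : ℝ} {x : F}
    (hg : HasDerivAt g g' ‖x‖) (hx : x ≠ 0) :
    HasGradientAt (fun w => g ‖w‖) ((g' / ‖x‖) • x) x := by
  have hx' : ‖x‖ ≠ 0 := norm_ne_zero_iff.mpr hx
  have hnorm := (hasStrictFDerivAt_norm_sq x).hasFDerivAt.sqrt (pow_ne_zero 2 hx')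
  simp only [Real.sqrt_sq (norm_nonneg _)] at hnorm
  rw [hasGradientAt_iff_hasFDerivAt]
  refine (hg.comp_hasFDerivAt x hnorm).congr_fderiv ?_
  ext y
  simp
  field_simp

/-- The derivative of `E` when `α s ^ 2 * s = 2 * E (√s)` for positive `s`. -/
theorem hasDerivAt_of_sq_mul_eq_two_mul_comp_sqrt {E α : ℝ → ℝ} {q : ℝ} (hq : 0 < q)
    (hα : DifferentiableAt ℝ α (q ^ 2))
    (hαE : ∀ s, 0 < s → α s ^ 2 * s = 2 * E (Real.sqrt s)) :
    HasDerivAt E (q * (α (q ^ 2) ^ 2 + 2 * α (q ^ 2) * deriv α (q ^ 2) * q ^ 2)) q := by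
  have hsq : HasDerivAt (fun x : ℝ => x ^ 2) (2 * q) q := by
    simpa using hasDerivAt_pow 2 q
  have hcomp : HasDerivAt (fun x : ℝ => α (x ^ 2)) (deriv α (q ^ 2) * (2 * q)) q :=
    HasDerivAt.comp (h := fun x : ℝ => x ^ 2) q hα.hasDerivAt hsq
  have hprod := ((hcomp.fun_pow 2).fun_mul hsq).div_const 2
  refine (hprod.congr_of_eventuallyEq ?_).congr_deriv ?_
  · filter_upwards [lt_mem_nhds hq] with x hx
    have := hαE (x ^ 2) (by positivity)
    rw [Real.sqrt_sq hx.le] at this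
    linarith
  · norm_num
    ring

/-- With `v := α(q²)·√(σ(h)/h)·p` and
`f(h,v) := √(σ(h))·√h·( (2α'(q²)h/(α(q²)²σ(h)))·(v ⊗ v) + α(q²)·I )`, one has
`f(h,v)·v = √(σ(h)h)·(α(q²) + 2α'(q²)q²)·v = σ(h)·(α(q²)² + 2α(q²)α'(q²)q²)·p`,
which is the gradient at `p` of `p ↦ Φ(h) + σ(h)·E_cap(‖p‖)`, i.e. `σ(h)·E_cap'(q)·p/q`. -/
theorem stmt2 (Φ σ Ecap α : ℝ → ℝ) (h : ℝ) (hh : 0 < h) (hσ : 0 < σ h)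
    (p : EuclideanSpace ℝ (Fin 2)) (hq : 0 < ‖p‖)
    (hα : DifferentiableAt ℝ α (‖p‖ ^ 2)) (hαpos : 0 < α (‖p‖ ^ 2))
    (hEc : DifferentiableAt ℝ Ecap ‖p‖)
    (hαE : ∀ s, 0 < s → α s ^ 2 * s = 2 * Ecap (Real.sqrt s))
    (v : EuclideanSpace ℝ (Fin 2))
    (hv : v = (α (‖p‖ ^ 2) * Real.sqrt (σ h / h)) • p)
    (f : Matrix (Fin 2) (Fin 2) ℝ)
    (hf : f = (Real.sqrt (σ h) * Real.sqrt h) •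
        ((2 * deriv α (‖p‖ ^ 2) * h / (α (‖p‖ ^ 2) ^ 2 * σ h)) • Matrix.vecMulVec v v
          + α (‖p‖ ^ 2) • (1 : Matrix (Fin 2) (Fin 2) ℝ))) :
    ((WithLp.equiv 2 (Fin 2 → ℝ)).symm (f.mulVec v)
        = (Real.sqrt (σ h * h) * (α (‖p‖ ^ 2) + 2 * deriv α (‖p‖ ^ 2) * ‖p‖ ^ 2)) • v)
    ∧ ((WithLp.equiv 2 (Fin 2 → ℝ)).symm (f.mulVec v)
        = (σ h * (α (‖p‖ ^ 2) ^ 2 + 2 * α (‖p‖ ^ 2) * deriv α (‖p‖ ^ 2) * ‖p‖ ^ 2)) • p)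
    ∧ ((WithLp.equiv 2 (Fin 2 → ℝ)).symm (f.mulVec v)
        = gradient (fun w : EuclideanSpace ℝ (Fin 2) => Φ h + σ h * Ecap ‖w‖) p)
    ∧ (gradient (fun w : EuclideanSpace ℝ (Fin 2) => Φ h + σ h * Ecap ‖w‖) p
        = (σ h * deriv Ecap ‖p‖ / ‖p‖) • p) := by
  have hE := hasDerivAt_of_sq_mul_eq_two_mul_comp_sqrt hq hα hαE
  have hgrad : gradient (fun w : EuclideanSpace ℝ (Fin 2) => Φ h + σ h * Ecap ‖w‖) p
      = (σ h * deriv Ecap ‖p‖ / ‖p‖) • p :=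
    (((hEc.hasDerivAt.const_mul (σ h)).const_add (Φ h)).hasGradientAt_comp_norm
      (norm_pos_iff.mp hq)).gradient
  have hnorm : ‖v‖ ^ 2 = α (‖p‖ ^ 2) ^ 2 * (σ h / h) * ‖p‖ ^ 2 := by
    rw [hv, norm_smul, mul_pow, Real.norm_eq_abs, sq_abs, mul_pow, Real.sq_sqrt (by positivity)]
  have hfv : (WithLp.equiv 2 (Fin 2 → ℝ)).symm (f.mulVec v)
      = (Real.sqrt (σ h * h) * (α (‖p‖ ^ 2) + 2 * deriv α (‖p‖ ^ 2) * ‖p‖ ^ 2)) • v := by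
    have hcoef : 2 * deriv α (‖p‖ ^ 2) * h / (α (‖p‖ ^ 2) ^ 2 * σ h) * ‖v‖ ^ 2 + α (‖p‖ ^ 2)
        = α (‖p‖ ^ 2) + 2 * deriv α (‖p‖ ^ 2) * ‖p‖ ^ 2 := by
      rw [hnorm]
      field_simp
      ring
    rw [hf, Matrix.smul_mulVec, smul_vecMulVec_self_add_smul_one_mulVec, hcoef, smul_smul,
      Real.sqrt_mul hσ.le]
    rfl
  have hfp : (WithLp.equiv 2 (Fin 2 → ℝ)).symm (f.mulVec v)
      = (σ h * (α (‖p‖ ^ 2) ^ 2 + 2 * α (‖p‖ ^ 2) * deriv α (‖p‖ ^ 2) * ‖p‖ ^ 2)) • p := by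
    have hsqrt : Real.sqrt (σ h * h) * Real.sqrt (σ h / h) = σ h := by
      rw [← Real.sqrt_mul (by positivity), show σ h * h * (σ h / h) = σ h ^ 2 by field_simp,
        Real.sqrt_sq hσ.le]
    rw [hfv, hv, smul_smul]
    congr 1
    linear_combination
      (α (‖p‖ ^ 2) + 2 * deriv α (‖p‖ ^ 2) * ‖p‖ ^ 2) * α (‖p‖ ^ 2) * hsqrt
  refine ⟨hfv, hfp, ?_, hgrad⟩
  rw [hfp, hgrad, hE.deriv]
  congr 1
  field_simp
end

section
/- Let h : ℝ × ℝ² → ℝ be C² and u : ℝ × ℝ² → ℝ² be C² with ∂ₜh + div(h·u) = 0 on ℝ × ℝ², and let α : ℝ → ℝ be C¹. Set q := ‖∇ₓh‖. Then ∂ₜ(α(q²)) + ⟨u, ∇ₓ(α(q²))⟩ = −2·α'(q²)·( ⟨∇ₓh, div(h·(∇ₓu)ᵀ)⟩ + q²·div u ). -/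
noncomputable section

/-- Spatial points of the plane (with the Euclidean structure). -/
abbrev Spc : Type := EuclideanSpace ℝ (Fin 2)

/-- Time derivative `∂ₜ f` of a scalar field on time-space `ℝ × ℝ²`. -/
noncomputable def dt (f : ℝ × Spc → ℝ) (z : ℝ × Spc) : ℝ :=
  fderiv ℝ f z (1, 0)

/-- Spatial partial derivative `∂ⱼ f` of a scalar field on time-space `ℝ × ℝ²`. -/
noncomputable def dx (j : Fin 2) (f : ℝ × Spc → ℝ) (z : ℝ × Spc) : ℝ :=
  fderiv ℝ f z (0, EuclideanSpace.single j 1)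

/-- Spatial gradient `∇ₓ f` (as a Euclidean vector) of a scalar field. -/
noncomputable def gradx (f : ℝ × Spc → ℝ) (z : ℝ × Spc) : Spc :=
  (WithLp.equiv 2 (Fin 2 → ℝ)).symm (fun i => dx i f z)

/-- Mixed directional derivatives of a `C²` function commute. -/
theorem fderiv_fderiv_apply_comm {E : Type*} [NormedAddCommGroup E] [NormedSpace ℝ E]
    {f : E → ℝ} (hf : ContDiff ℝ 2 f) (z v w : E) :
    fderiv ℝ (fun y => fderiv ℝ f y v) z w = fderiv ℝ (fun y => fderiv ℝ f y w) z v := by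
  have hd : DifferentiableAt ℝ (fderiv ℝ f) z :=
    ((hf.fderiv_right (m := 1) (by norm_num)).differentiable (by norm_num)) z
  have key : ∀ a b : E, fderiv ℝ (fun y => fderiv ℝ f y a) z b
      = fderiv ℝ (fderiv ℝ f) z b a := fun a b => by
    rw [fderiv_clm_apply hd (differentiableAt_const a)]
    simp
  rw [key, key]
  exact (hf.contDiffAt.isSymmSndFDerivAt (by simp)).eq w v

/-- The directional derivatives of a `C²` function are differentiable. -/
theorem ContDiff.differentiable_fderiv_apply_const {E : Type*} [NormedAddCommGroup E]
    [NormedSpace ℝ E] {f : E → ℝ} (hf : ContDiff ℝ 2 f) (v : E) :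
    Differentiable ℝ (fun y => fderiv ℝ f y v) :=
  ((hf.fderiv_right (m := 1) (by norm_num)).differentiable (by norm_num)).clm_apply
    (differentiable_const v)

theorem fderiv_mul_apply_eq {E : Type*} [NormedAddCommGroup E] [NormedSpace ℝ E]
    {f g : E → ℝ} (hf : Differentiable ℝ f) (hg : Differentiable ℝ g) (z v : E) :
    fderiv ℝ (fun y => f y * g y) z v = f z * fderiv ℝ g z v + g z * fderiv ℝ f z v := by
  rw [fderiv_fun_mul (hf z) (hg z)]
  simp

theorem fderiv_add_apply_eq {E : Type*} [NormedAddCommGroup E] [NormedSpace ℝ E]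
    {f g : E → ℝ} (hf : Differentiable ℝ f) (hg : Differentiable ℝ g) (z v : E) :
    fderiv ℝ (fun y => f y + g y) z v = fderiv ℝ f z v + fderiv ℝ g z v := by
  rw [fderiv_fun_add (hf z) (hg z)]
  simp

/-- With `q := ‖∇ₓh‖`, if `∂ₜh + div(h·u) = 0` then
`∂ₜ(α(q²)) + ⟨u, ∇ₓ(α(q²))⟩ = −2α'(q²)·(⟨∇ₓh, div(h·(∇ₓu)ᵀ)⟩ + q²·div u)`. -/
theorem stmt8 (h : ℝ × Spc → ℝ) (u : ℝ × Spc → Spc) (α : ℝ → ℝ)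
    (hh : ContDiff ℝ 2 h) (hu : ContDiff ℝ 2 u) (hα : ContDiff ℝ 1 α)
    (mass : ∀ z, dt h z + ∑ j, dx j (fun y => h y * u y j) z = 0)
    (q : ℝ × Spc → ℝ) (hq : ∀ z, q z = ‖gradx h z‖) :
    ∀ z : ℝ × Spc,
      dt (fun y => α (q y ^ 2)) z + ∑ j, u z j * dx j (fun y => α (q y ^ 2)) z
        = -2 * deriv α (q z ^ 2) *
            ((∑ i, dx i h z * ∑ j, dx j (fun y => h y * dx i (fun y' => u y' j) y) z)
              + q z ^ 2 * ∑ j, dx j (fun y => u y j) z) := by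
  intro z
  have hd : Differentiable ℝ h := hh.differentiable (by norm_num)
  have hu' : ∀ j, ContDiff ℝ 2 (fun y => u y j) := fun j => contDiff_euclidean.1 hu j
  have ud : ∀ j, Differentiable ℝ (fun y => u y j) := fun j => (hu' j).differentiable (by norm_num)
  have hdd := hh.differentiable_fderiv_apply_const
  have udd := fun j => (hu' j).differentiable_fderiv_apply_const
  have hq2 : ∀ y, q y ^ 2 = dx 0 h y * dx 0 h y + dx 1 h y * dx 1 h y := fun y => by
    rw [hq, EuclideanSpace.norm_sq_eq]
    simp [gradx, Fin.sum_univ_two, sq]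
  have chain : ∀ v, fderiv ℝ (fun y => α (q y ^ 2)) z v = deriv α (q z ^ 2) *
      (2 * (dx 0 h z * fderiv ℝ (dx 0 h) z v + dx 1 h z * fderiv ℝ (dx 1 h) z v)) := fun v => by
    have d0 : Differentiable ℝ (dx 0 h) := hdd _
    have d1 : Differentiable ℝ (dx 1 h) := hdd _
    simp only [hq2]
    have hα' : HasDerivAt α (deriv α (dx 0 h z * dx 0 h z + dx 1 h z * dx 1 h z))
        (dx 0 h z * dx 0 h z + dx 1 h z * dx 1 h z) :=
      (hα.differentiable (by norm_num) _).hasDerivAt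
    have hc := hα'.comp_hasFDerivAt z (((d0.fun_mul d0).fun_add (d1.fun_mul d1)) z).hasFDerivAt
    have he := congrArg (fun L => L v) hc.fderiv
    refine he.trans ?_
    change _ * fderiv ℝ (fun y => dx 0 h y * dx 0 h y + dx 1 h y * dx 1 h y) z v = _
    rw [fderiv_add_apply_eq (d0.fun_mul d0) (d1.fun_mul d1), fderiv_mul_apply_eq d0 d0,
      fderiv_mul_apply_eq d1 d1]
    ring
  have dt_eq : dt h = fun y => -((h y * dx 0 (fun y => u y 0) y + u y 0 * dx 0 h y)
      + (h y * dx 1 (fun y => u y 1) y + u y 1 * dx 1 h y)) := by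
    funext y
    have hm := mass y
    simp only [Fin.sum_univ_two, dx] at hm ⊢
    rw [fderiv_mul_apply_eq hd (ud 0), fderiv_mul_apply_eq hd (ud 1)] at hm
    linarith
  have dt_dx : ∀ i, fderiv ℝ (dx i h) z (1, 0) = _ := fun i =>
    (fderiv_fderiv_apply_comm hh z _ _).trans
      (congrArg (fun f => fderiv ℝ f z (0, EuclideanSpace.single i 1)) dt_eq)
  have hs := fderiv_fderiv_apply_comm hh z
  have us := fun j => fderiv_fderiv_apply_comm (hu' j) z
  have e : ∀ i, fderiv ℝ (dx i h) z (1, 0) =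
      -((h z * dx 0 (dx i (fun y => u y 0)) z + dx 0 (fun y => u y 0) z * dx i h z
          + (u z 0 * dx 0 (dx i h) z + dx 0 h z * dx i (fun y => u y 0) z))
        + (h z * dx 1 (dx i (fun y => u y 1)) z + dx 1 (fun y => u y 1) z * dx i h z
          + (u z 1 * dx 1 (dx i h) z + dx 1 h z * dx i (fun y => u y 1) z))) := fun i => by
    rw [dt_dx i]
    unfold dx
    rw [fderiv_fun_neg, neg_apply,
      fderiv_add_apply_eq ((hd.fun_mul (udd 0 _)).fun_add ((ud 0).fun_mul (hdd _)))
        ((hd.fun_mul (udd 1 _)).fun_add ((ud 1).fun_mul (hdd _))),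
      fderiv_add_apply_eq (hd.fun_mul (udd 0 _)) ((ud 0).fun_mul (hdd _)),
      fderiv_add_apply_eq (hd.fun_mul (udd 1 _)) ((ud 1).fun_mul (hdd _)),
      fderiv_mul_apply_eq hd (udd 0 _), fderiv_mul_apply_eq hd (udd 1 _),
      fderiv_mul_apply_eq (ud 0) (hdd _), fderiv_mul_apply_eq (ud 1) (hdd _),
      us 0 (0, EuclideanSpace.single 0 1), us 1 (0, EuclideanSpace.single 1 1),
      hs (0, EuclideanSpace.single 0 1), hs (0, EuclideanSpace.single 1 1)]
  have r : ∀ i j, dx j (fun y => h y * dx i (fun y' => u y' j) y) z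
      = h z * dx j (dx i (fun y => u y j)) z + dx i (fun y => u y j) z * dx j h z :=
    fun i j => fderiv_mul_apply_eq hd (udd j _) z _
  have c : ∀ j, dx j (fun y => α (q y ^ 2)) z = deriv α (q z ^ 2) *
      (2 * (dx 0 h z * dx j (dx 0 h) z + dx 1 h z * dx j (dx 1 h) z)) := fun j => chain _
  have ct : dt (fun y => α (q y ^ 2)) z = _ := chain (1, 0)
  simp only [Fin.sum_univ_two, r, c, ct, e]
  generalize deriv α (q z ^ 2) = a
  rw [hq2]
  ring

end
end

section
/- Let h : ℝ × ℝ² → ℝ and u : ℝ × ℝ² → ℝ² be smooth with h > 0 and ‖∇ₓh‖ > 0 everywhere, let Φ, σ, E_cap : ℝ → ℝ be smooth with σ > 0, assume α(s) := √(2·E_cap(√s)/s) is C¹ and positive on (0,∞), and set q := ‖∇ₓh‖, π(h) := h·Φ'(h) − Φ(h), v := α(q²)·√(σ(h)/h)·∇ₓh. If (h,u) satisfies the augmented momentum equation ∂ₜ(h·u) + div(h·u ⊗ u) + ∇ₓ(π(h)) = div(h·(∇ₓ(f(h,v)·v))ᵀ) − ∇ₓ(⟨g(h,v), v⟩), then (h,u)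 satisfies the original momentum equation with full surface tension: ∂ₜ(h·u) + div(h·u ⊗ u) + ∇ₓP = −div(∇ₓh ⊗ ∇_pE) + ∇ₓ(h·div(∇_pE)), where ∇_pE denotes the gradient of p ↦ Φ(h) + σ(h)·E_cap(‖p‖) evaluated at p = ∇ₓh, and P = π(h) − (σ(h) − h·σ'(h))·E_cap(q). -/
noncomputable section

lemma contDiff_dx {f : ℝ × Spc → ℝ} (hf : ContDiff ℝ (⊤ : ℕ∞) f) (j : Fin 2) :
    ContDiff ℝ (⊤ : ℕ∞) (dx j f) := by
  unfold dx
  exact (hf.fderiv_right (m := (⊤ : ℕ∞)) (by simp)).clm_apply contDiff_const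

lemma dx_add {f g : ℝ × Spc → ℝ} (hf : ContDiff ℝ (⊤ : ℕ∞) f) (hg : ContDiff ℝ (⊤ : ℕ∞) g)
    (j : Fin 2) (z : ℝ × Spc) : dx j (fun y => f y + g y) z = dx j f z + dx j g z := by
  unfold dx
  rw [fderiv_fun_add (hf.differentiable (by simp) z) (hg.differentiable (by simp) z)]
  rfl

lemma dx_sub {f g : ℝ × Spc → ℝ} (hf : ContDiff ℝ (⊤ : ℕ∞) f) (hg : ContDiff ℝ (⊤ : ℕ∞) g)
    (j : Fin 2) (z : ℝ × Spc) : dx j (fun y => f y - g y) z = dx j f z - dx j g z := by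
  unfold dx
  rw [fderiv_fun_sub (hf.differentiable (by simp) z) (hg.differentiable (by simp) z)]
  rfl

lemma dx_mul {f g : ℝ × Spc → ℝ} (hf : ContDiff ℝ (⊤ : ℕ∞) f) (hg : ContDiff ℝ (⊤ : ℕ∞) g)
    (j : Fin 2) (z : ℝ × Spc) :
    dx j (fun y => f y * g y) z = f z * dx j g z + dx j f z * g z := by
  unfold dx
  rw [fderiv_fun_mul (hf.differentiable (by simp) z) (hg.differentiable (by simp) z)]
  simp [mul_comm]

/-- Mixed spatial partial derivatives of a smooth field commute. -/
lemma dx_comm {f : ℝ × Spc → ℝ} (hf : ContDiff ℝ (⊤ : ℕ∞) f) (i j : Fin 2) (z : ℝ × Spc) :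
    dx i (dx j f) z = dx j (dx i f) z := by
  have hd : DifferentiableAt ℝ (fderiv ℝ f) z :=
    (hf.fderiv_right (m := (⊤ : ℕ∞)) (by simp)).differentiable (by simp) z
  have key : ∀ a b : Fin 2, dx a (dx b f) z
      = fderiv ℝ (fderiv ℝ f) z (0, EuclideanSpace.single a 1)
        (0, EuclideanSpace.single b 1) := by
    intro a b
    unfold dx
    rw [fderiv_clm_apply hd (differentiableAt_const _)]
    simp
  rw [key, key]
  have hs : IsSymmSndFDerivAt ℝ f z :=
    (hf.contDiffAt (x := z)).isSymmSndFDerivAt (by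
      simpa using WithTop.coe_le_coe.2 (le_top : (2 : ℕ∞) ≤ ⊤))
  exact hs _ _

/-- The commutation identity `∂ⱼ(h ∂ᵢw) + ∂ⱼ(∂ᵢh w) = ∂ᵢ(h ∂ⱼw) + ∂ᵢ(∂ⱼh w)`. -/
lemma dx_mul_comm {h w : ℝ × Spc → ℝ} (hh : ContDiff ℝ (⊤ : ℕ∞) h)
    (hw : ContDiff ℝ (⊤ : ℕ∞) w) (i j : Fin 2) (z : ℝ × Spc) :
    dx j (fun y => h y * dx i w y) z + dx j (fun y => dx i h y * w y) z
      = dx i (fun y => h y * dx j w y) z + dx i (fun y => dx j h y * w y) z := by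
  rw [dx_mul hh (contDiff_dx hw i), dx_mul (contDiff_dx hh i) hw,
    dx_mul hh (contDiff_dx hw j), dx_mul (contDiff_dx hh j) hw, dx_comm hw i j, dx_comm hh i j]
  ring

lemma norm_gradx (h : ℝ × Spc → ℝ) (z : ℝ × Spc) :
    ‖gradx h z‖ = Real.sqrt (dx 0 h z ^ 2 + dx 1 h z ^ 2) := by
  simp [EuclideanSpace.norm_eq, gradx, Fin.sum_univ_two]

/-- The gradient of an affine function of a radial energy, away from the origin. -/
lemma gradient_radial {F : ℝ → ℝ} {p : Spc} (hF : DifferentiableAt ℝ F ‖p‖) (hp : p ≠ 0)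
    (c s : ℝ) :
    gradient (fun w : Spc => c + s * F ‖w‖) p = (s * (deriv F ‖p‖ / ‖p‖)) • p := by
  have hp' : 0 < ‖p‖ := norm_pos_iff.2 hp
  have h1 : HasFDerivAt (fun w : Spc => ‖w‖ ^ 2) (2 • innerSL ℝ p) p :=
    (hasStrictFDerivAt_norm_sq p).hasFDerivAt
  have h2 := h1.sqrt (by positivity)
  have h3 : HasFDerivAt (fun w : Spc => ‖w‖) ((1 / (2 * √(‖p‖ ^ 2))) • (2 • innerSL ℝ p)) p := by
    refine h2.congr_of_eventuallyEq (Filter.Eventually.of_forall fun w => ?_)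
    simp [Real.sqrt_sq (norm_nonneg w)]
  have h4 := ((hF.hasDerivAt.comp_hasFDerivAt p h3).const_mul s).const_add c
  apply HasGradientAt.gradient
  rw [hasGradientAt_iff_hasFDerivAt]
  refine h4.congr_fderiv ?_
  ext w
  simp [Real.sqrt_sq hp'.le]
  field_simp

/-- Differentiating `α(s)² s = 2 E(√s)` at `s = q²`. -/
lemma deriv_capillary {Ecap α : ℝ → ℝ} (hE : Differentiable ℝ Ecap)
    (hα : ∀ s, 0 < s → α s ^ 2 * s = 2 * Ecap (Real.sqrt s)) {q : ℝ} (hq : 0 < q)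
    (hd : DifferentiableAt ℝ α (q ^ 2)) :
    α (q ^ 2) ^ 2 + 2 * α (q ^ 2) * deriv α (q ^ 2) * q ^ 2 = deriv Ecap q / q := by
  have hs : 0 < q ^ 2 := by positivity
  have h1 : HasDerivAt (fun s => α s ^ 2 * s) _ (q ^ 2) :=
    (hd.hasDerivAt.pow 2).mul (hasDerivAt_id (q ^ 2))
  have h2 : HasDerivAt (fun s => 2 * Ecap (Real.sqrt s)) _ (q ^ 2) :=
    ((hE (Real.sqrt (q ^ 2))).hasDerivAt.comp (q ^ 2)
      (Real.hasDerivAt_sqrt hs.ne')).const_mul 2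
  have h3 : (fun s => α s ^ 2 * s) =ᶠ[nhds (q ^ 2)] fun s => 2 * Ecap (Real.sqrt s) := by
    filter_upwards [lt_mem_nhds hs] with s h using hα s h
  have h4 := h1.unique (h2.congr_of_eventuallyEq h3)
  simp only [Real.sqrt_sq hq.le, Pi.pow_apply] at h4
  field_simp at h4 ⊢
  norm_num at h4
  linarith

/-- (Lemma 2.1(iii), momentum part.) If `(h,u)` satisfies the
augmented momentum equation
`∂ₜ(hu) + div(hu ⊗ u) + ∇ₓ(π(h)) = div(h·(∇ₓ(f(h,v)·v))ᵀ) − ∇ₓ(⟨g(h,v), v⟩)`,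
then `(h,u)` satisfies the original momentum equation with full surface tension
`∂ₜ(hu) + div(hu ⊗ u) + ∇ₓP = −div(∇ₓh ⊗ ∇_pE) + ∇ₓ(h·div(∇_pE))`,
where `∇_pE` is the gradient of `p ↦ Φ(h) + σ(h)·E_cap(‖p‖)` at `p = ∇ₓh` and
`P = π(h) − (σ(h) − h·σ'(h))·E_cap(q)`. -/
theorem stmt10 (h : ℝ × Spc → ℝ) (u : ℝ × Spc → Spc) (Φ σ Ecap α : ℝ → ℝ)
    (hh : ContDiff ℝ (⊤ : ℕ∞) h) (hu : ContDiff ℝ (⊤ : ℕ∞) u)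
    (hΦ : ContDiff ℝ (⊤ : ℕ∞) Φ) (hσ : ContDiff ℝ (⊤ : ℕ∞) σ) (hEc : ContDiff ℝ (⊤ : ℕ∞) Ecap)
    (hσpos : ∀ s, 0 < σ s)
    (hpos : ∀ z, 0 < h z)
    (q : ℝ × Spc → ℝ) (hq : ∀ z, q z = ‖gradx h z‖) (hqpos : ∀ z, 0 < q z)
    (hα : ∀ s, 0 < s → α s = Real.sqrt (2 * Ecap (Real.sqrt s) / s))
    (hαC : ContDiffOn ℝ 1 α (Set.Ioi (0 : ℝ)))
    (hαpos : ∀ s, 0 < s → 0 < α s)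
    (v : ℝ × Spc → Fin 2 → ℝ)
    (hv : ∀ z i, v z i = α (q z ^ 2) * Real.sqrt (σ (h z) / h z) * dx i h z)
    (f : ℝ × Spc → Matrix (Fin 2) (Fin 2) ℝ)
    (hf : ∀ z, f z = (Real.sqrt (σ (h z)) * Real.sqrt (h z)) •
        ((2 * deriv α (q z ^ 2) * h z / (α (q z ^ 2) ^ 2 * σ (h z))) •
            Matrix.vecMulVec (v z) (v z)
          + α (q z ^ 2) • (1 : Matrix (Fin 2) (Fin 2) ℝ)))
    (g : ℝ × Spc → Fin 2 → ℝ)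
    (hg : ∀ z, g z = ((deriv σ (h z) * h z / (2 * σ (h z)) + 1 / 2
        + 2 * deriv α (q z ^ 2) * q z ^ 2 / α (q z ^ 2)) * h z) • v z)
    -- the gradient `∇_pE` of `p ↦ Φ(h) + σ(h)·E_cap(‖p‖)` evaluated at `p = ∇ₓh`
    (Gp : ℝ × Spc → Spc)
    (hGp : ∀ z, Gp z = gradient
        (fun w : Spc => Φ (h z) + σ (h z) * Ecap ‖w‖) (gradx h z))
    -- the augmented momentum equation
    (mom : ∀ (z : ℝ × Spc) (i : Fin 2),
      dt (fun y => h y * u y i) z + ∑ j, dx j (fun y => h y * u y i * u y j) z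
          + dx i (fun y => h y * deriv Φ (h y) - Φ (h y)) z
        = ∑ j, dx j (fun y => h y * dx i (fun y' => ∑ k, f y' j k * v y' k) y) z
          - dx i (fun y => ∑ j, g y j * v y j) z) :
    -- the original momentum equation with full surface tension
    ∀ (z : ℝ × Spc) (i : Fin 2),
      dt (fun y => h y * u y i) z + ∑ j, dx j (fun y => h y * u y i * u y j) z
          + dx i (fun y => (h y * deriv Φ (h y) - Φ (h y))
              - (σ (h y) - h y * deriv σ (h y)) * Ecap (q y)) z
        = -(∑ j, dx j (fun y => dx i h y * Gp y j) z)
          + dx i (fun y => h y * ∑ j, dx j (fun y' => Gp y' j) y) z := by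
  have hp : ∀ z, gradx h z ≠ 0 := fun z => by
    rw [← norm_pos_iff, ← hq]; exact hqpos z
  have hq2 : ∀ z, q z ^ 2 = dx 0 h z ^ 2 + dx 1 h z ^ 2 := fun z => by
    rw [hq, norm_gradx, Real.sq_sqrt (by positivity)]
  have hαsq : ∀ s, 0 < s → α s ^ 2 * s = 2 * Ecap (Real.sqrt s) := fun s hs => by
    have h1 := hαpos s hs
    rw [hα s hs] at h1 ⊢
    rw [Real.sq_sqrt (Real.sqrt_pos.1 h1).le]
    field_simp
  have hE : ∀ z, Ecap (q z) = α (q z ^ 2) ^ 2 * q z ^ 2 / 2 := fun z => by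
    rw [hαsq _ (pow_pos (hqpos z) 2), Real.sqrt_sq (hqpos z).le]
    ring
  have hκ : ∀ z, α (q z ^ 2) ^ 2 + 2 * α (q z ^ 2) * deriv α (q z ^ 2) * q z ^ 2
      = deriv Ecap (q z) / q z := fun z =>
    deriv_capillary (hEc.differentiable (by simp)) hαsq (hqpos z)
      ((hαC.differentiableOn (by simp)).differentiableAt
        (Ioi_mem_nhds (pow_pos (hqpos z) 2)))
  have hG : ∀ z j, Gp z j = σ (h z) * (deriv Ecap (q z) / q z) * dx j h z := fun z j => by
    rw [hGp, gradient_radial (hEc.differentiable (by simp) _) (hp z), ← hq]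
    simp [gradx]
  -- smoothness of the fields involved
  have hdc : ∀ {F : ℝ → ℝ}, ContDiff ℝ (⊤ : ℕ∞) F → ContDiff ℝ (⊤ : ℕ∞) (deriv F) :=
    fun hF => (contDiff_infty_iff_deriv.1 hF).2
  have hqC : ContDiff ℝ (⊤ : ℕ∞) q := by
    have : q = fun z => Real.sqrt (dx 0 h z ^ 2 + dx 1 h z ^ 2) :=
      funext fun z => by rw [hq, norm_gradx]
    rw [this]
    refine (((contDiff_dx hh 0).pow 2).add ((contDiff_dx hh 1).pow 2)).sqrt fun z => ?_
    rw [← hq2]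
    exact (pow_pos (hqpos z) 2).ne'
  have hGC : ∀ j, ContDiff ℝ (⊤ : ℕ∞) (fun z => Gp z j) := fun j => by
    simp only [hG]
    exact ((hσ.comp hh).mul (((hdc hEc).comp hqC).div hqC fun z => (hqpos z).ne')).mul
      (contDiff_dx hh j)
  have hπC : ContDiff ℝ (⊤ : ℕ∞) (fun y => h y * deriv Φ (h y) - Φ (h y)) :=
    (hh.mul ((hdc hΦ).comp hh)).sub (hΦ.comp hh)
  have hRC : ContDiff ℝ (⊤ : ℕ∞)
      (fun y => (σ (h y) - h y * deriv σ (h y)) * Ecap (q y)) :=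
    ((hσ.comp hh).sub (hh.mul ((hdc hσ).comp hh))).mul (hEc.comp hqC)
  have hpGC : ∀ j, ContDiff ℝ (⊤ : ℕ∞) (fun y => dx j h y * Gp y j) := fun j =>
    (contDiff_dx hh j).mul (hGC j)
  -- algebraic identification of the auxiliary fields
  have hvv : ∀ z, v z 0 * v z 0 + v z 1 * v z 1
      = α (q z ^ 2) ^ 2 * (σ (h z) / h z) * q z ^ 2 := fun z => by
    have hr := Real.sq_sqrt (div_pos (hσpos (h z)) (hpos z)).le
    rw [hv, hv]
    linear_combination α (q z ^ 2) ^ 2 * (dx 0 h z ^ 2 + dx 1 h z ^ 2) * hr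
      - α (q z ^ 2) ^ 2 * (σ (h z) / h z) * hq2 z
  have hfv : ∀ z j, ∑ k, f z j k * v z k = Gp z j := fun z j => by
    have hσ0 := hσpos (h z)
    have hh0 := hpos z
    have hα0 := hαpos _ (pow_pos (hqpos z) 2)
    have hr : Real.sqrt (σ (h z)) * Real.sqrt (h z) * Real.sqrt (σ (h z) / h z) = σ (h z) := by
      rw [Real.sqrt_div hσ0.le]
      have := Real.sqrt_pos.2 hh0
      field_simp
      exact Real.sq_sqrt hσ0.le
    have h1 : ∑ k, f z j k * v z k = Real.sqrt (σ (h z)) * Real.sqrt (h z) *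
        (2 * deriv α (q z ^ 2) * h z / (α (q z ^ 2) ^ 2 * σ (h z))
          * (v z 0 * v z 0 + v z 1 * v z 1) + α (q z ^ 2)) * v z j := by
      rw [hf]
      fin_cases j <;> simp [Fin.sum_univ_two, Matrix.vecMulVec_apply] <;> ring
    have h2 : 2 * deriv α (q z ^ 2) * h z / (α (q z ^ 2) ^ 2 * σ (h z))
        * (α (q z ^ 2) ^ 2 * (σ (h z) / h z) * q z ^ 2)
        = 2 * deriv α (q z ^ 2) * q z ^ 2 := by
      field_simp
    rw [h1, hvv, h2, hG, ← hκ, hv]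
    linear_combination (2 * deriv α (q z ^ 2) * q z ^ 2 + α (q z ^ 2)) * α (q z ^ 2)
      * dx j h z * hr
  have hgv : ∀ z, ∑ j, g z j * v z j = (dx 0 h z * Gp z 0 + dx 1 h z * Gp z 1)
      - (σ (h z) - h z * deriv σ (h z)) * Ecap (q z) := fun z => by
    have hσ0 := hσpos (h z)
    have hh0 := hpos z
    have hα0 := hαpos _ (pow_pos (hqpos z) 2)
    have h1 : ∑ j, g z j * v z j = (deriv σ (h z) * h z / (2 * σ (h z)) + 1 / 2
        + 2 * deriv α (q z ^ 2) * q z ^ 2 / α (q z ^ 2)) * h z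
          * (v z 0 * v z 0 + v z 1 * v z 1) := by
      rw [hg]
      simp [Fin.sum_univ_two]
      ring
    have h2 : dx 0 h z * Gp z 0 + dx 1 h z * Gp z 1
        = σ (h z) * (α (q z ^ 2) ^ 2 + 2 * α (q z ^ 2) * deriv α (q z ^ 2) * q z ^ 2)
          * q z ^ 2 := by
      rw [hG, hG, hκ]
      linear_combination - σ (h z) * (deriv Ecap (q z) / q z) * hq2 z
    rw [h1, hvv, h2, hE]
    generalize α (q z ^ 2) = a at *
    generalize deriv α (q z ^ 2) = a' at *
    field_simp
    ring
  intro z i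
  have hm := mom z i
  simp only [hfv, hgv] at hm
  rw [dx_sub ((hpGC 0).add (hpGC 1)) hRC, dx_add (hpGC 0) (hpGC 1)] at hm
  rw [dx_sub hπC hRC]
  have hdiv : (fun y => h y * ∑ j, dx j (fun y' => Gp y' j) y) = fun y =>
      h y * dx 0 (fun y' => Gp y' 0) y + h y * dx 1 (fun y' => Gp y' 1) y := by
    funext y
    rw [Fin.sum_univ_two, mul_add]
  rw [hdiv, dx_add (hh.mul (contDiff_dx (hGC 0) 0)) (hh.mul (contDiff_dx (hGC 1) 1))]
  have c0 := dx_mul_comm hh (hGC 0) i 0 z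
  have c1 := dx_mul_comm hh (hGC 1) i 1 z
  simp only [Fin.sum_univ_two] at hm ⊢
  linarith

end
end

section
/- For all doubly periodic grid scalar functions h and grid vector fields u = (uˣ,uʸ) and m = (mˣ,mʸ) indexed by ZMod n₁ × ZMod n₂, the discrete operator div_{1Δ}(h·∇_{1Δ}(·)ᵀ) is self-adjoint for the discrete inner product: (u, div_{1Δ}(h·∇_{1Δ}mᵀ)) = (m, div_{1Δ}(h·∇_{1Δ}uᵀ)). -/
noncomputable section

/-- First component of the discrete operator `div_{1Δ}(h·∇_{1Δ}mᵀ)` on doubly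
periodic grid functions, for a grid vector field `m = (mx, my)`. -/
def div1x {n₁ n₂ : ℕ} (Δx Δy : ℝ) (h mx my : ZMod n₁ → ZMod n₂ → ℝ)
    (i : ZMod n₁) (j : ZMod n₂) : ℝ :=
  ((h i j + h (i + 1) j) / 2 * (mx (i + 1) j - mx i j)
      - (h (i - 1) j + h i j) / 2 * (mx i j - mx (i - 1) j)) / Δx ^ 2
    + (h i (j + 1) * (my (i + 1) (j + 1) - my (i - 1) (j + 1))
      - h i (j - 1) * (my (i + 1) (j - 1) - my (i - 1) (j - 1))) / (4 * Δx * Δy)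

/-- Second component of the discrete operator `div_{1Δ}(h·∇_{1Δ}mᵀ)` on doubly
periodic grid functions, for a grid vector field `m = (mx, my)`. -/
def div1y {n₁ n₂ : ℕ} (Δx Δy : ℝ) (h mx my : ZMod n₁ → ZMod n₂ → ℝ)
    (i : ZMod n₁) (j : ZMod n₂) : ℝ :=
  (h (i + 1) j * (mx (i + 1) (j + 1) - mx (i + 1) (j - 1))
      - h (i - 1) j * (mx (i - 1) (j + 1) - mx (i - 1) (j - 1))) / (4 * Δx * Δy)
    + ((h i j + h i (j + 1)) / 2 * (my i (j + 1) - my i j)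
      - (h i (j - 1) + h i j) / 2 * (my i j - my i (j - 1))) / Δy ^ 2

/-- A three-point second-difference operator in flux form on a finite cyclic grid is symmetric. -/
theorem sum_mul_flux_sub_flux_comm {n : ℕ} [NeZero n] (h u m : ZMod n → ℝ) :
    ∑ i, u i * ((h i + h (i + 1)) / 2 * (m (i + 1) - m i)
        - (h (i - 1) + h i) / 2 * (m i - m (i - 1)))
      = ∑ i, m i * ((h i + h (i + 1)) / 2 * (u (i + 1) - u i)
        - (h (i - 1) + h i) / 2 * (u i - u (i - 1))) := by
  have shift := (Equiv.subRight (1 : ZMod n)).sum_comp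
    fun i ↦ (h i + h (i + 1)) / 2 * (u i * m (i + 1) - m i * u (i + 1))
  simp only [Equiv.subRight_apply, sub_add_cancel] at shift
  rw [← sub_eq_zero] at shift ⊢
  rw [← neg_eq_zero, ← shift, ← Finset.sum_sub_distrib, ← Finset.sum_sub_distrib,
    ← Finset.sum_neg_distrib]
  exact Finset.sum_congr rfl fun i _ ↦ by ring

/-- The two mixed centred-difference operators on a doubly periodic grid are mutually adjoint. -/
theorem sum_mul_mixed_difference_comm {n₁ n₂ : ℕ} [NeZero n₁] [NeZero n₂]
    (h u v : ZMod n₁ → ZMod n₂ → ℝ) :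
    ∑ i, ∑ j, u i j * (h i (j + 1) * (v (i + 1) (j + 1) - v (i - 1) (j + 1))
        - h i (j - 1) * (v (i + 1) (j - 1) - v (i - 1) (j - 1)))
      = ∑ i, ∑ j, v i j * (h (i + 1) j * (u (i + 1) (j + 1) - u (i + 1) (j - 1))
        - h (i - 1) j * (u (i - 1) (j + 1) - u (i - 1) (j - 1))) := by
  have left : ∑ i, ∑ j, u i j * (h i (j + 1) * (v (i + 1) (j + 1) - v (i - 1) (j + 1))
        - h i (j - 1) * (v (i + 1) (j - 1) - v (i - 1) (j - 1)))
      = ∑ i, ∑ j, h i j * (u i (j - 1) - u i (j + 1)) * (v (i + 1) j - v (i - 1) j) := by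
    refine Finset.sum_congr rfl fun i _ ↦ ?_
    have up := Equiv.sum_comp (Equiv.addRight (1 : ZMod n₂))
      fun j ↦ u i (j - 1) * (h i j * (v (i + 1) j - v (i - 1) j))
    have down := (Equiv.subRight (1 : ZMod n₂)).sum_comp
      fun j ↦ u i (j + 1) * (h i j * (v (i + 1) j - v (i - 1) j))
    simp only [Equiv.coe_addRight, Equiv.subRight_apply, add_sub_cancel_right,
      sub_add_cancel] at up down
    simp only [mul_sub (u _ _), Finset.sum_sub_distrib (f := fun j ↦ u i j * _)]
    rw [up, down, ← Finset.sum_sub_distrib]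
    exact Finset.sum_congr rfl fun j _ ↦ by ring
  have right : ∑ i, ∑ j, v i j * (h (i + 1) j * (u (i + 1) (j + 1) - u (i + 1) (j - 1))
        - h (i - 1) j * (u (i - 1) (j + 1) - u (i - 1) (j - 1)))
      = ∑ i, ∑ j, h i j * (u i (j - 1) - u i (j + 1)) * (v (i + 1) j - v (i - 1) j) := by
    rw [Finset.sum_comm]
    conv_rhs => rw [Finset.sum_comm]
    refine Finset.sum_congr rfl fun j _ ↦ ?_
    have up := Equiv.sum_comp (Equiv.addRight (1 : ZMod n₁))
      fun i ↦ v (i - 1) j * (h i j * (u i (j + 1) - u i (j - 1)))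
    have down := (Equiv.subRight (1 : ZMod n₁)).sum_comp
      fun i ↦ v (i + 1) j * (h i j * (u i (j + 1) - u i (j - 1)))
    simp only [Equiv.coe_addRight, Equiv.subRight_apply, add_sub_cancel_right,
      sub_add_cancel] at up down
    simp only [mul_sub (v _ _), Finset.sum_sub_distrib (f := fun i ↦ v i j * _)]
    rw [up, down, ← Finset.sum_sub_distrib]
    exact Finset.sum_congr rfl fun i _ ↦ by ring
  rw [left, right]

/-- The inner product of a grid vector field with the discrete operator, split by components. -/
theorem sum_mul_div1_eq {n₁ n₂ : ℕ} [NeZero n₁] [NeZero n₂] (Δx Δy : ℝ)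
    (h ux uy mx my : ZMod n₁ → ZMod n₂ → ℝ) :
    ∑ i, ∑ j, Δx * Δy *
        (ux i j * div1x Δx Δy h mx my i j + uy i j * div1y Δx Δy h mx my i j)
      = Δx * Δy / Δx ^ 2 * (∑ j, ∑ i, ux i j *
            ((h i j + h (i + 1) j) / 2 * (mx (i + 1) j - mx i j)
              - (h (i - 1) j + h i j) / 2 * (mx i j - mx (i - 1) j)))
        + Δx * Δy / (4 * Δx * Δy) * ((∑ i, ∑ j, ux i j *
            (h i (j + 1) * (my (i + 1) (j + 1) - my (i - 1) (j + 1))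
              - h i (j - 1) * (my (i + 1) (j - 1) - my (i - 1) (j - 1))))
          + ∑ i, ∑ j, uy i j *
            (h (i + 1) j * (mx (i + 1) (j + 1) - mx (i + 1) (j - 1))
              - h (i - 1) j * (mx (i - 1) (j + 1) - mx (i - 1) (j - 1))))
        + Δx * Δy / Δy ^ 2 * (∑ i, ∑ j, uy i j *
            ((h i j + h i (j + 1)) / 2 * (my i (j + 1) - my i j)
              - (h i (j - 1) + h i j) / 2 * (my i j - my i (j - 1)))) := by
  rw [Finset.sum_comm (s := (Finset.univ : Finset (ZMod n₂)))
    (t := (Finset.univ : Finset (ZMod n₁)))]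
  simp only [Finset.mul_sum, ← Finset.sum_add_distrib]
  refine Finset.sum_congr rfl fun i _ ↦ Finset.sum_congr rfl fun j _ ↦ ?_
  simp only [div1x, div1y]
  ring

/-- (Lemma 3.1.) The discrete operator `div_{1Δ}(h·∇_{1Δ}(·)ᵀ)` is
self-adjoint for the discrete inner product
`(a,b) = Σᵢⱼ Δx·Δy·⟨aᵢⱼ, bᵢⱼ⟩` on doubly periodic grid vector fields:
`(u, div_{1Δ}(h·∇_{1Δ}mᵀ)) = (m, div_{1Δ}(h·∇_{1Δ}uᵀ))`. -/
theorem stmt12 (n₁ n₂ : ℕ) [NeZero n₁] [NeZero n₂] (Δx Δy : ℝ)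
    (hΔx : 0 < Δx) (hΔy : 0 < Δy)
    (h ux uy mx my : ZMod n₁ → ZMod n₂ → ℝ) :
    ∑ i : ZMod n₁, ∑ j : ZMod n₂, Δx * Δy *
        (ux i j * div1x Δx Δy h mx my i j + uy i j * div1y Δx Δy h mx my i j)
      = ∑ i : ZMod n₁, ∑ j : ZMod n₂, Δx * Δy *
          (mx i j * div1x Δx Δy h ux uy i j + my i j * div1y Δx Δy h ux uy i j) := by
  rw [sum_mul_div1_eq, sum_mul_div1_eq, sum_mul_mixed_difference_comm h ux my,
    sum_mul_mixed_difference_comm h mx uy, add_comm (∑ i, ∑ j, my i j * _),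
    Finset.sum_congr rfl fun j _ ↦
      sum_mul_flux_sub_flux_comm (h · j) (ux · j) (mx · j),
    Finset.sum_congr rfl fun i _ ↦ sum_mul_flux_sub_flux_comm (h i) (uy i) (my i)]

end
end

section
/- Let n₁, n₂ ≥ 1 and let u, m, h : ZMod n₁ × ZMod n₂ → ℝ be doubly periodic grid functions. Then Σ_{i,j} u_{i,j}·( h_{i,j+1}·(m_{i+1,j+1} − m_{i−1,j+1}) − h_{i,j−1}·(m_{i+1,j−1} − m_{i−1,j−1}) ) = Σ_{i,j} m_{i,j}·( h_{i+1,j}·(u_{i+1,j+1} − u_{i+1,j−1}) − h_{i−1,j}·(u_{i−1,j+1} − u_{i−1,j−1}) ). -/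
/-- A double sum over finite groups is invariant under translation in both variables. -/
theorem sum_sum_add_right {G H M : Type*} [AddGroup G] [AddGroup H] [Fintype G] [Fintype H]
    [AddCommMonoid M] (F : G → H → M) (a : G) (b : H) :
    ∑ i, ∑ j, F (i + a) (j + b) = ∑ i, ∑ j, F i j := by
  rw [← Equiv.sum_comp (Equiv.addRight a) fun i => ∑ j, F i j]
  exact Finset.sum_congr rfl fun i _ =>
    Equiv.sum_comp (Equiv.addRight b) fun j => F (i + a) j


/-- Doubly periodic mixed-difference summation identity used in
the proof of self-adjointness of `div_{1Δ}(h·∇_{1Δ}(·)ᵀ)`. -/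
theorem stmt14 (n₁ n₂ : ℕ) [NeZero n₁] [NeZero n₂]
    (u m h : ZMod n₁ → ZMod n₂ → ℝ) :
    ∑ i : ZMod n₁, ∑ j : ZMod n₂,
        u i j * (h i (j + 1) * (m (i + 1) (j + 1) - m (i - 1) (j + 1))
          - h i (j - 1) * (m (i + 1) (j - 1) - m (i - 1) (j - 1)))
      = ∑ i : ZMod n₁, ∑ j : ZMod n₂,
          m i j * (h (i + 1) j * (u (i + 1) (j + 1) - u (i + 1) (j - 1))
            - h (i - 1) j * (u (i - 1) (j + 1) - u (i - 1) (j - 1))) := by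
  have hpp := sum_sum_add_right (fun i j => m i j * h (i - 1) j * u (i - 1) (j - 1)) 1 1
  have hmp := sum_sum_add_right (fun i j => m i j * h (i + 1) j * u (i + 1) (j - 1)) (-1) 1
  have hpm := sum_sum_add_right (fun i j => m i j * h (i - 1) j * u (i - 1) (j + 1)) 1 (-1)
  have hmm := sum_sum_add_right (fun i j => m i j * h (i + 1) j * u (i + 1) (j + 1)) (-1) (-1)
  simp only [add_sub_cancel_right, ← sub_eq_add_neg,
    sub_add_cancel] at hpp hmp hpm hmm
  calc
    _ = (∑ i, ∑ j, m (i + 1) (j + 1) * h i (j + 1) * u i j)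
        - (∑ i, ∑ j, m (i - 1) (j + 1) * h i (j + 1) * u i j)
        - (∑ i, ∑ j, m (i + 1) (j - 1) * h i (j - 1) * u i j)
        + ∑ i, ∑ j, m (i - 1) (j - 1) * h i (j - 1) * u i j := by
      simp only [← Finset.sum_sub_distrib, ← Finset.sum_add_distrib]
      refine Finset.sum_congr rfl fun i _ => Finset.sum_congr rfl fun j _ => ?_
      ring
    _ = _ := by
      rw [hpp, hmp, hpm, hmm]
      simp only [← Finset.sum_sub_distrib, ← Finset.sum_add_distrib]
      refine Finset.sum_congr rfl fun i _ => Finset.sum_congr rfl fun j _ => ?_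
      ring
end

section
/- Let n₁, n₂ ≥ 1 and Δx, Δy > 0. Let h be a doubly periodic scalar grid function, f a grid function with values in symmetric 2×2 real matrices, g a grid vector field, and u, v doubly periodic grid vector fields indexed by ZMod n₁ × ZMod n₂. Then the discrete capillary operator is skew-symmetric for the discrete inner product: (u, div_{1Δ}(h·∇_{1Δ}(f·v)ᵀ) − ∇_{3Δ}(⟨g, v⟩)) + (v, −f·div_{1Δ}(h·∇_{1Δ}uᵀ) − g·div_{3Δ}(u)) = 0. -/
noncomputable section

/-- Centered discrete divergence `div_{3Δ}` of a grid vector field `a = (ax, ay)`. -/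
def div3 {n₁ n₂ : ℕ} (Δx Δy : ℝ) (ax ay : ZMod n₁ → ZMod n₂ → ℝ)
    (i : ZMod n₁) (j : ZMod n₂) : ℝ :=
  (ax (i + 1) j - ax (i - 1) j) / (2 * Δx) + (ay i (j + 1) - ay i (j - 1)) / (2 * Δy)

/-- First component of the centered discrete gradient `∇_{3Δ}` of a scalar grid
function `φ`. -/
def grad3x {n₁ n₂ : ℕ} (Δx : ℝ) (φ : ZMod n₁ → ZMod n₂ → ℝ)
    (i : ZMod n₁) (j : ZMod n₂) : ℝ :=
  (φ (i + 1) j - φ (i - 1) j) / (2 * Δx)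

/-- Second component of the centered discrete gradient `∇_{3Δ}` of a scalar grid
function `φ`. -/
def grad3y {n₁ n₂ : ℕ} (Δy : ℝ) (φ : ZMod n₁ → ZMod n₂ → ℝ)
    (i : ZMod n₁) (j : ZMod n₂) : ℝ :=
  (φ i (j + 1) - φ i (j - 1)) / (2 * Δy)

/-- Summation by parts for the centered difference on a finite abelian group. -/
theorem sum_mul_centered_diff {G : Type*} [AddCommGroup G] [Fintype G] (s : G) (u a : G → ℝ) :
    ∑ i, u i * (a (i + s) - a (i - s)) = -∑ i, a i * (u (i + s) - u (i - s)) := by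
  have h₁ : ∑ i, u i * a (i + s) = ∑ i, u (i - s) * a i :=
    Fintype.sum_equiv (Equiv.addRight s) _ _ fun i => by simp
  have h₂ : ∑ i, u i * a (i - s) = ∑ i, u (i + s) * a i :=
    Fintype.sum_equiv (Equiv.subRight s) _ _ fun i => by simp
  simp only [mul_comm (a _), sub_mul, mul_sub, Finset.sum_sub_distrib, h₁, h₂]
  ring

/-- Summation by parts for the difference of a flux taken at half-integer points. -/
theorem sum_mul_flux_diff {G : Type*} [AddCommGroup G] [Fintype G] (s : G) (h u w : G → ℝ) :
    ∑ i, u i * ((h i + h (i + s)) / 2 * (w (i + s) - w i)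
        - (h (i - s) + h i) / 2 * (w i - w (i - s)))
      = -∑ i, (h i + h (i + s)) / 2 * (w (i + s) - w i) * (u (i + s) - u i) := by
  have h₁ : ∑ i, u i * ((h (i - s) + h i) / 2 * (w i - w (i - s)))
      = ∑ i, u (i + s) * ((h i + h (i + s)) / 2 * (w (i + s) - w i)) :=
    Fintype.sum_equiv (Equiv.subRight s) _ _ fun i => by simp
  simp only [mul_sub (u _), Finset.sum_sub_distrib, h₁]
  rw [← Finset.sum_sub_distrib, ← Finset.sum_neg_distrib]
  exact Finset.sum_congr rfl fun i _ => by ring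

/-- The bilinear form of `div_{1Δ}(h·∇_{1Δ}mᵀ)`, in a form visibly symmetric under the exchange
of `u` and `w`. -/
theorem sum_mul_div1 {n₁ n₂ : ℕ} [NeZero n₁] [NeZero n₂] (Δx Δy : ℝ)
    (h ux uy wx wy : ZMod n₁ → ZMod n₂ → ℝ) :
    ∑ i, ∑ j, (ux i j * div1x Δx Δy h wx wy i j + uy i j * div1y Δx Δy h wx wy i j)
      = -∑ i, ∑ j,
        ((h i j + h (i + 1) j) / 2 * (wx (i + 1) j - wx i j) * (ux (i + 1) j - ux i j) / Δx ^ 2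
        + h i j * (wy (i + 1) j - wy (i - 1) j) * (ux i (j + 1) - ux i (j - 1)) / (4 * Δx * Δy)
        + h i j * (wx i (j + 1) - wx i (j - 1)) * (uy (i + 1) j - uy (i - 1) j) / (4 * Δx * Δy)
        + (h i j + h i (j + 1)) / 2 * (wy i (j + 1) - wy i j) * (uy i (j + 1) - uy i j)
          / Δy ^ 2) := by
  have hxx (j : ZMod n₂) := sum_mul_flux_diff 1 (h · j) (ux · j) (wx · j)
  have hyy (i : ZMod n₁) := sum_mul_flux_diff 1 (h i) (uy i) (wy i)
  have hxy (i : ZMod n₁) := sum_mul_centered_diff 1 (ux i)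
    (fun j => h i j * (wy (i + 1) j - wy (i - 1) j))
  have hyx (j : ZMod n₂) := sum_mul_centered_diff 1 (uy · j)
    (fun i => h i j * (wx i (j + 1) - wx i (j - 1)))
  simp only [div1x, div1y, mul_add (ux _ _), mul_add (uy _ _), ← mul_div_assoc,
    Finset.sum_add_distrib, ← Finset.sum_div, hxy, hyy]
  rw [Finset.sum_comm, Finset.sum_comm (f := fun i j => uy i j * _)]
  simp only [hxx, hyx, Finset.sum_neg_distrib]
  rw [Finset.sum_comm, Finset.sum_comm (γ := ZMod n₂) (f := fun j i =>
    h i j * (wx i (j + 1) - wx i (j - 1)) * (uy (i + 1) j - uy (i - 1) j))]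
  ring

/-- The operator `div_{1Δ}(h·∇_{1Δ}mᵀ)` is self-adjoint. -/
theorem sum_mul_div1_comm {n₁ n₂ : ℕ} [NeZero n₁] [NeZero n₂] (Δx Δy : ℝ)
    (h ux uy wx wy : ZMod n₁ → ZMod n₂ → ℝ) :
    ∑ i, ∑ j, (ux i j * div1x Δx Δy h wx wy i j + uy i j * div1y Δx Δy h wx wy i j)
      = ∑ i, ∑ j, (wx i j * div1x Δx Δy h ux uy i j + wy i j * div1y Δx Δy h ux uy i j) := by
  rw [sum_mul_div1, sum_mul_div1]
  congr 1
  exact Finset.sum_congr rfl fun i _ => Finset.sum_congr rfl fun j _ => by ring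

/-- The centered gradient is minus the adjoint of the centered divergence. -/
theorem sum_mul_grad3 {n₁ n₂ : ℕ} [NeZero n₁] [NeZero n₂] (Δx Δy : ℝ)
    (ux uy φ : ZMod n₁ → ZMod n₂ → ℝ) :
    ∑ i, ∑ j, (ux i j * grad3x Δx φ i j + uy i j * grad3y Δy φ i j)
      = -∑ i, ∑ j, φ i j * div3 Δx Δy ux uy i j := by
  have hx (j : ZMod n₂) := sum_mul_centered_diff 1 (ux · j) (φ · j)
  have hy (i : ZMod n₁) := sum_mul_centered_diff 1 (uy i) (φ i)
  simp only [grad3x, grad3y, div3, mul_add, ← mul_div_assoc, Finset.sum_add_distrib,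
    ← Finset.sum_div, hy]
  rw [Finset.sum_comm]
  simp only [hx, Finset.sum_neg_distrib]
  rw [Finset.sum_comm]
  ring

/-- Skew-symmetry of the discrete capillary operator for the
discrete inner product: for a scalar grid function `h`, a symmetric-matrix-valued
grid function `f = (fxx fxy; fyx fyy)`, a grid vector field `g = (gx, gy)` and grid
vector fields `u = (ux, uy)`, `v = (vx, vy)`,
`(u, div_{1Δ}(h·∇_{1Δ}(f·v)ᵀ) − ∇_{3Δ}(⟨g, v⟩)) + (v, −f·div_{1Δ}(h·∇_{1Δ}uᵀ) − g·div_{3Δ}u) = 0`. -/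
theorem stmt19 (n₁ n₂ : ℕ) [NeZero n₁] [NeZero n₂] (Δx Δy : ℝ)
    (hΔx : 0 < Δx) (hΔy : 0 < Δy)
    (h fxx fxy fyx fyy gx gy ux uy vx vy : ZMod n₁ → ZMod n₂ → ℝ)
    (hsym : ∀ i j, fxy i j = fyx i j) :
    (∑ i : ZMod n₁, ∑ j : ZMod n₂, Δx * Δy *
        (ux i j * (div1x Δx Δy h
            (fun i j => fxx i j * vx i j + fxy i j * vy i j)
            (fun i j => fyx i j * vx i j + fyy i j * vy i j) i j
          - grad3x Δx (fun i j => gx i j * vx i j + gy i j * vy i j) i j)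
        + uy i j * (div1y Δx Δy h
            (fun i j => fxx i j * vx i j + fxy i j * vy i j)
            (fun i j => fyx i j * vx i j + fyy i j * vy i j) i j
          - grad3y Δy (fun i j => gx i j * vx i j + gy i j * vy i j) i j)))
    + (∑ i : ZMod n₁, ∑ j : ZMod n₂, Δx * Δy *
        (vx i j * (-(fxx i j * div1x Δx Δy h ux uy i j
              + fxy i j * div1y Δx Δy h ux uy i j)
            - gx i j * div3 Δx Δy ux uy i j)
        + vy i j * (-(fyx i j * div1x Δx Δy h ux uy i j
              + fyy i j * div1y Δx Δy h ux uy i j)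
            - gy i j * div3 Δx Δy ux uy i j)))
    = 0 := by
  have hD := sum_mul_div1_comm Δx Δy h ux uy
    (fun i j => fxx i j * vx i j + fxy i j * vy i j)
    (fun i j => fyx i j * vx i j + fyy i j * vy i j)
  have hG := sum_mul_grad3 Δx Δy ux uy (fun i j => gx i j * vx i j + gy i j * vy i j)
  rw [← sub_eq_zero] at hD
  rw [← sub_eq_zero, sub_neg_eq_add] at hG
  have key := congrArg₂ (fun a b => Δx * Δy * (a - b)) hD hG
  simp only [sub_zero, mul_zero] at key
  rw [← key]
  simp only [← Finset.sum_add_distrib, ← Finset.sum_sub_distrib, Finset.mul_sum]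
  refine Finset.sum_congr rfl fun i _ => Finset.sum_congr rfl fun j _ => ?_
  rw [hsym i j]
  ring

end
end
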